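/- arXiv:1508.06892 — 4 statements merged into one kernel-verified Lean document; each statement's English description precedes it below -/
import Mathlib

section
/- A finite connected graph G of order n ≥ 2 satisfies h(G) = 2(n − 1) if and only if G is a tree. -/
/-- The Hamiltonian number of a graph: the minimum length of a closed, spanning walk. -/
noncomputable def hamiltonianNumber {V : Type*} [Fintype V] (G : SimpleGraph V) : ℕ :=
  sInf {k : ℕ | ∃ (v : V) (w : G.Walk v v), (∀ u : V, u ∈ w.support) ∧ w.length = k}

open SimpleGraph in
lemma hn_extend {V : Type*} [Fintype V] [DecidableEq V] (G : SimpleGraph V) (hG : G.Connected) :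
    ∀ (m : ℕ) (v : V) (w : G.Walk v v), Fintype.card V - w.support.toFinset.card = m →
      ∃ (v' : V) (w' : G.Walk v' v'), (∀ u : V, u ∈ w'.support) ∧
        w'.length ≤ w.length + 2 * m := by
  intro m
  induction m with
  | zero =>
    intro v w h
    refine ⟨v, w, fun u => ?_, by omega⟩
    have h1 : w.support.toFinset = Finset.univ := by
      rw [← Finset.card_eq_iff_eq_univ]
      have := Finset.card_le_univ w.support.toFinset
      omega
    have := Finset.mem_univ u
    rw [← h1] at this
    simpa using this
  | succ m ih =>
    intro v w h
    have : ∃ x, x ∉ w.support := by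
      by_contra! hc
      have h1 : w.support.toFinset = Finset.univ := by ext; simp [hc]
      rw [h1, Finset.card_univ] at h
      omega
    obtain ⟨x, hx⟩ := this
    obtain ⟨p⟩ := hG.preconnected v x
    obtain ⟨d, -, hd1, hd2⟩ := p.exists_boundary_dart {a | a ∈ w.support}
      (w.start_mem_support) hx
    let w1 := w.rotate d.fst hd1
    let w2 : G.Walk d.fst d.fst := Walk.cons d.adj (Walk.cons d.adj.symm w1)
    have hl : w1.length = w.length := by simp [w1]
    have hmem : ∀ a, a ∈ w1.support ↔ a ∈ w.support := fun a => by
      simp [w1]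
    have hs : w2.support.toFinset = insert d.snd w.support.toFinset := by
      ext a
      have : d.fst ∈ w.support := hd1
      simp only [w2, Walk.support_cons, List.toFinset_cons, Finset.mem_insert, List.mem_toFinset,
        hmem]
      constructor
      · rintro (rfl | h | h) <;> simp_all
      · tauto
    have hc : w2.support.toFinset.card = w.support.toFinset.card + 1 := by
      rw [hs, Finset.card_insert_of_notMem]
      simpa using hd2
    obtain ⟨v', w', h1, h2⟩ := ih d.fst w2 (by omega)
    refine ⟨v', w', h1, ?_⟩
    have : w2.length = w.length + 2 := by simp [w2, hl]
    omega

open SimpleGraph in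
lemma hn_lower {V : Type*} [Fintype V] (G : SimpleGraph V) (hG : G.IsTree)
    (v : V) (w : G.Walk v v) (hw : ∀ u, u ∈ w.support) :
    2 * (Fintype.card V - 1) ≤ w.length := by
  classical
  have key : ∀ e ∈ G.edgeFinset, 2 ≤ w.edges.count e := by
    intro e he
    induction e with | h a b =>
    have hab : G.Adj a b := by simpa using he
    have hb := isAcyclic_iff_forall_adj_isBridge.1 hG.isAcyclic hab
    rw [isBridge_iff_forall_walk_mem_edges] at hb
    have hba : b ∈ (w.rotate a (hw a)).support := by simp [hw]
    have h1 := hb ((w.rotate a (hw a)).takeUntil b hba)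
    have h2 := hb ((w.rotate a (hw a)).dropUntil b hba).reverse
    rw [Walk.edges_reverse, List.mem_reverse] at h2
    have h3 := congrArg (fun p => p.edges.count s(a, b)) ((w.rotate a (hw a)).take_spec hba)
    simp only [Walk.edges_append, List.count_append] at h3
    have h4 : (w.rotate a (hw a)).edges.count s(a, b) = w.edges.count s(a, b) :=
      (w.rotate_edges a (hw a)).perm.count_eq _
    have := List.count_pos_iff.2 h1
    have := List.count_pos_iff.2 h2
    omega
  have hE := hG.card_edgeFinset
  have h1 : ∑ e ∈ G.edgeFinset, w.edges.count e = w.length := by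
    have := Multiset.sum_count_eq_card (s := G.edgeFinset) (m := (w.edges : Multiset (Sym2 V)))
      (fun e he => by simpa using w.edges_subset_edgeSet (by simpa using he))
    simpa using this
  have h2 := Finset.sum_le_sum key
  simp only [Finset.sum_const, smul_eq_mul] at h2
  omega

/-- A finite connected graph `G` of order `n ≥ 2` satisfies `h(G) = 2 * (n - 1)`
if and only if `G` is a tree. -/
theorem hamiltonianNumber_eq_two_mul_card_sub_one_iff_isTree {V : Type*} [Fintype V]
    (G : SimpleGraph V) (hG : G.Connected) (hn : 2 ≤ Fintype.card V) :
    hamiltonianNumber G = 2 * (Fintype.card V - 1) ↔ G.IsTree := by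
  classical
  constructor
  · intro h
    refine ⟨hG, ?_⟩
    intro v c hc
    obtain ⟨v', w', h1, h2⟩ := hn_extend G hG _ v c rfl
    have h3 : hamiltonianNumber G ≤ w'.length := Nat.sInf_le ⟨v', w', h1, rfl⟩
    have h4 := hc.three_le_length
    have h5 : c.length ≤ c.support.toFinset.card := by
      have h6 : c.support.tail.toFinset.card = c.length := by
        rw [List.toFinset_card_of_nodup hc.support_nodup]
        simp
      rw [← h6]
      apply Finset.card_le_card
      intro a ha
      simp only [List.mem_toFinset] at ha ⊢
      exact List.mem_of_mem_tail ha
    have h7 := Finset.card_le_univ c.support.toFinset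
    omega
  · intro hT
    obtain ⟨v⟩ := hG.nonempty
    obtain ⟨v', w', h1, h2⟩ := hn_extend G hG _ v SimpleGraph.Walk.nil rfl
    have h3 : hamiltonianNumber G ≤ w'.length := Nat.sInf_le ⟨v', w', h1, rfl⟩
    obtain ⟨x, p, hp, hl⟩ := Nat.sInf_mem
      (s := {k : ℕ | ∃ (v : V) (w : G.Walk v v), (∀ u : V, u ∈ w.support) ∧ w.length = k})
      ⟨_, v', w', h1, rfl⟩
    have h4 := hn_lower G hT x p hp
    change p.length = hamiltonianNumber G at hl
    simp at h2
    omega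
end

section
/- Let G be a finite connected graph of order n ≥ 2. Then h(G) equals the minimum of the Hamiltonian spectrum of G; that is, h(G) = min over all cyclic orderings s : v_1, v_2, …, v_n, v_{n+1} = v_1 of the vertices of G of the quantity d(s) = Σ_{i=1}^{n} dist(v_i, v_{i+1}), where dist denotes the graph distance in G. -/
/-- Total distance travelled from `a` through the vertices of the list to `b`. -/
noncomputable def hChain {V : Type*} (G : SimpleGraph V) : V → List V → V → ℕ
  | a, [], b => G.dist a b
  | a, x :: l, b => G.dist a x + hChain G x l b

theorem hChain_head {V : Type*} (G : SimpleGraph V) (hG : G.Connected) (a c : V) (l : List V)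
    (b : V) : hChain G a l b ≤ G.dist a c + hChain G c l b := by
  cases l with
  | nil => exact hG.dist_triangle
  | cons x l =>
    have := hG.dist_triangle (u := a) (v := c) (w := x)
    simp only [hChain]; omega

theorem hChain_last {V : Type*} (G : SimpleGraph V) (hG : G.Connected) (l : List V) (b c : V) :
    ∀ a, hChain G a l c ≤ hChain G a l b + G.dist b c := by
  induction l with
  | nil => intro a; exact hG.dist_triangle
  | cons x l ih =>
    intro a
    have := ih x
    simp only [hChain]; omega

theorem hChain_le_walk {V : Type*} (G : SimpleGraph V) (hG : G.Connected) {a b : V}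
    (w : G.Walk a b) : ∀ l : List V, l.Sublist w.support → hChain G a l b ≤ w.length := by
  induction w with
  | nil =>
    intro l hl
    simp only [SimpleGraph.Walk.support_nil] at hl
    rcases List.sublist_singleton.1 hl with rfl | rfl <;> simp [hChain]
  | @cons u v w h p ih =>
    have key : ∀ l : List V, l.Sublist p.support → hChain G u l w ≤ p.length + 1 := by
      intro l hl
      have h1 := ih l hl
      have h2 := hChain_head G hG u v l w
      have h3 : G.dist u v = 1 := SimpleGraph.dist_eq_one_iff_adj.2 h
      omega
    intro l hl
    rw [SimpleGraph.Walk.support_cons] at hl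
    rw [SimpleGraph.Walk.length_cons]
    cases hl with
    | cons _ hl => exact key l hl
    | cons_cons _ hl =>
      simp only [hChain, SimpleGraph.dist_self, Nat.zero_add]
      exact key _ hl

theorem exists_walk_hChain {V : Type*} (G : SimpleGraph V) (hG : G.Connected) (b : V)
    (l : List V) : ∀ a, ∃ w : G.Walk a b, w.length = hChain G a l b ∧ ∀ u ∈ l, u ∈ w.support := by
  induction l with
  | nil =>
    intro a
    obtain ⟨w, hw⟩ := hG.exists_walk_length_eq_dist a b
    exact ⟨w, hw, by simp⟩
  | cons x l ih =>
    intro a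
    obtain ⟨p, hp⟩ := hG.exists_walk_length_eq_dist a x
    obtain ⟨q, hq, hs⟩ := ih x
    refine ⟨p.append q, by simp [hChain, hp, hq], ?_⟩
    intro u hu
    rw [SimpleGraph.Walk.mem_support_append_iff]
    rcases List.mem_cons.1 hu with rfl | hu
    · left; simp
    · right; exact hs u hu

theorem hChain_ofFn {V : Type*} (G : SimpleGraph V) (b : V) (m : ℕ) :
    ∀ s : Fin (m + 1) → V, hChain G (s 0) (List.ofFn fun i : Fin m => s i.succ) b =
      ∑ i : Fin m, G.dist (s i.castSucc) (s i.succ) + G.dist (s (Fin.last m)) b := by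
  induction m with
  | zero => intro s; simp [hChain]
  | succ m ih =>
    intro s
    have := ih (fun i => s i.succ)
    rw [List.ofFn_succ, hChain, this, Fin.sum_univ_succ]
    simp [add_assoc]

theorem sum_rotate_eq {V : Type*} (G : SimpleGraph V) (m : ℕ) (s : Fin (m + 1) → V) :
    ∑ i, G.dist (s i) (s (finRotate (m + 1) i)) =
      hChain G (s 0) (List.ofFn fun i : Fin m => s i.succ) (s 0) := by
  rw [hChain_ofFn, Fin.sum_univ_castSucc]
  simp [Fin.coeSucc_eq_succ]

theorem hamiltonianNumber_eq_min_hamiltonianSpectrum {V : Type*} [Fintype V]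
    (G : SimpleGraph V) (hG : G.Connected) (n : ℕ) (hn : Fintype.card V = n)
    (h2 : 2 ≤ n) :
    hamiltonianNumber G =
      sInf {d : ℕ | ∃ s : Fin n ≃ V,
        d = ∑ i : Fin n, G.dist (s i) (s (finRotate n i))} := by
  classical
  obtain ⟨m, rfl⟩ : ∃ m, n = m + 1 := ⟨n - 1, by omega⟩
  have hsub : ∀ s : Fin (m + 1) ≃ V, ∃ (v : V) (w : G.Walk v v), (∀ u : V, u ∈ w.support) ∧
      w.length = ∑ i : Fin (m + 1), G.dist (s i) (s (finRotate (m + 1) i)) := by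
    intro s
    obtain ⟨w, hw, hs⟩ := exists_walk_hChain G hG (s 0)
      (List.ofFn fun i : Fin m => s i.succ) (s 0)
    refine ⟨s 0, w, ?_, by rw [hw, sum_rotate_eq]⟩
    intro u
    obtain ⟨i, rfl⟩ := s.surjective u
    refine Fin.cases ?_ (fun j => ?_) i
    · simp
    · exact hs _ (by rw [List.mem_ofFn]; exact ⟨j, rfl⟩)
  have s0 : Fin (m + 1) ≃ V := (Fintype.equivFinOfCardEq hn).symm
  unfold hamiltonianNumber
  apply le_antisymm
  · refine le_csInf ⟨_, s0, rfl⟩ ?_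
    rintro d ⟨s, rfl⟩
    exact Nat.sInf_le (hsub s)
  · refine le_csInf ⟨_, hsub s0⟩ ?_
    rintro d ⟨v, w, hw, rfl⟩
    have hnd := w.support.nodup_dedup
    have hmem : ∀ u, u ∈ w.support.dedup := fun u => List.mem_dedup.2 (hw u)
    have hle := hChain_le_walk G hG w _ w.support.dedup_sublist
    generalize w.support.dedup = l at hnd hmem hle
    have e := hnd.getEquivOfForallMemList l hmem
    have hlen : l.length = m + 1 := by
      rw [← hn, ← Fintype.card_congr e, Fintype.card_fin]
    let s : Fin (m + 1) ≃ V := (finCongr hlen.symm).trans (hnd.getEquivOfForallMemList l hmem)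
    have hl : l = List.ofFn (fun i => s i) := by
      apply List.ext_get
      · simp [hlen]
      · intro k h1 h2
        rw [List.get_ofFn]; rfl
    refine le_trans (Nat.sInf_le ⟨s, rfl⟩) (le_trans ?_ hle)
    rw [sum_rotate_eq G m s, hl, List.ofFn_succ, hChain]
    have := hChain_last G hG (List.ofFn fun i : Fin m => s i.succ) v (s 0) (s 0)
    omega
end

section
/- (Bermond's Ore-type bound) Let G be a finite connected graph of order n ≥ 3 and let c be an integer with c ≤ n. If deg(v) + deg(w) ≥ c for every pair of distinct non-adjacent vertices v and w of G, then h(G) ≤ 2n − c. -/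
/-- `f 0, …, f m` is a path in `G`. -/
def IsP {V : Type*} (G : SimpleGraph V) (f : ℕ → V) (m : ℕ) : Prop :=
  (∀ i j, i ≤ m → j ≤ m → f i = f j → i = j) ∧ ∀ i, i < m → G.Adj (f i) (f (i + 1))

lemma ham_le {V : Type*} [Fintype V] {G : SimpleGraph V} {v : V} (w : G.Walk v v)
    (hw : ∀ u, u ∈ w.support) : hamiltonianNumber G ≤ w.length :=
  Nat.sInf_le ⟨v, w, hw, rfl⟩

lemma exists_bdry {V : Type*} {G : SimpleGraph V} (hG : G.Connected) (S : Set V) {a b : V}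
    (ha : a ∈ S) (hb : b ∉ S) : ∃ x y, x ∈ S ∧ y ∉ S ∧ G.Adj x y := by
  obtain ⟨p⟩ := hG.preconnected a b
  obtain ⟨d, _, h1, h2⟩ := p.exists_boundary_dart S ha hb
  exact ⟨_, _, h1, h2, d.adj⟩

lemma ham_extend {V : Type*} [Fintype V] [DecidableEq V] {G : SimpleGraph V} (hG : G.Connected)
    (k : ℕ) : ∀ (v : V) (w : G.Walk v v), Fintype.card V ≤ w.support.toFinset.card + k →
    hamiltonianNumber G ≤ w.length + 2 * k := by
  induction k with
  | zero =>
    intro v w h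
    have huniv : w.support.toFinset = Finset.univ :=
      (Finset.card_eq_iff_eq_univ _).1 (le_antisymm (Finset.card_le_univ _) (by simpa using h))
    refine (ham_le w fun u => ?_).trans (by omega)
    have := Finset.mem_univ u
    rw [← huniv] at this
    simpa using this
  | succ k ih =>
    intro v w h
    by_cases hs : ∀ u, u ∈ w.support
    · exact (ham_le w hs).trans (by omega)
    push Not at hs
    obtain ⟨u, hu⟩ := hs
    obtain ⟨x, y, hx, hy, hxy⟩ := exists_bdry hG {z | z ∈ w.support} (a := v) (b := u) (by simp) hu
    simp only [Set.mem_ofPred_eq] at hx hy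
    let q : G.Walk v v := (w.takeUntil x hx).append
      (SimpleGraph.Walk.cons hxy (SimpleGraph.Walk.cons hxy.symm (w.dropUntil x hx)))
    have hl : q.length = w.length + 2 := by
      have := congrArg SimpleGraph.Walk.length (w.take_spec hx)
      simp only [SimpleGraph.Walk.length_append] at this
      simp only [q, SimpleGraph.Walk.length_append, SimpleGraph.Walk.length_cons]
      omega
    have hsub : insert y w.support.toFinset ⊆ q.support.toFinset := by
      intro z hz
      simp only [Finset.mem_insert, List.mem_toFinset] at hz
      simp only [q, List.mem_toFinset, SimpleGraph.Walk.mem_support_append_iff,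
        SimpleGraph.Walk.support_cons, List.mem_cons]
      rcases hz with rfl | hz
      · right; right; left; rfl
      · rw [← w.take_spec hx, SimpleGraph.Walk.mem_support_append_iff] at hz
        tauto
    have hc := Finset.card_le_card hsub
    rw [Finset.card_insert_of_notMem (by simpa using hy)] at hc
    have := ih v q (by omega)
    omega

lemma IsP.walk {V : Type*} {G : SimpleGraph V} {f : ℕ → V} {m : ℕ} (hf : IsP G f m) (i d : ℕ)
    (h : i + d ≤ m) : ∃ w : G.Walk (f i) (f (i + d)), w.length = d ∧
      ∀ k, i ≤ k → k ≤ i + d → f k ∈ w.support := by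
  induction d with
  | zero =>
    refine ⟨SimpleGraph.Walk.nil, rfl, fun k h1 h2 => ?_⟩
    obtain rfl : k = i := by omega
    simp
  | succ d ih =>
    obtain ⟨w, hl, hw⟩ := ih (by omega)
    refine ⟨w.concat (hf.2 (i + d) (by omega)), by simp [hl], fun k h1 h2 => ?_⟩
    rw [SimpleGraph.Walk.support_concat]
    by_cases hk : k ≤ i + d
    · simp [hw k h1 hk]
    · obtain rfl : k = i + (d + 1) := by omega
      simp [← add_assoc]

lemma IsP.walk' {V : Type*} {G : SimpleGraph V} {f : ℕ → V} {m : ℕ} (hf : IsP G f m) (i j : ℕ)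
    (hij : i ≤ j) (h : j ≤ m) : ∃ w : G.Walk (f i) (f j), w.length = j - i ∧
      ∀ k, i ≤ k → k ≤ j → f k ∈ w.support := by
  obtain ⟨d, rfl⟩ := Nat.exists_eq_add_of_le hij
  simpa using hf.walk i d h

lemma IsP.rev {V : Type*} {G : SimpleGraph V} {f : ℕ → V} {m : ℕ} (hf : IsP G f m) :
    IsP G (fun k => f (m - k)) m := by
  refine ⟨fun i j hi hj h => ?_, fun i hi => ?_⟩
  · have := hf.1 _ _ (by omega) (by omega) h
    omega
  · have := (hf.2 (m - (i + 1)) (by omega)).symm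
    rwa [show m - (i + 1) + 1 = m - i by omega] at this

lemma IsP.ext_left {V : Type*} {G : SimpleGraph V} {f : ℕ → V} {m : ℕ} (hf : IsP G f m)
    (hmax : ¬ ∃ g, IsP G g (m + 1)) {x : V} (hx : G.Adj (f 0) x) : ∃ k, k ≤ m ∧ f k = x := by
  by_contra hcon
  push Not at hcon
  refine hmax ⟨fun k => if k = 0 then x else f (k - 1), fun i j hi hj h => ?_, fun i hi => ?_⟩
  · rcases Nat.eq_zero_or_pos i with rfl | hi' <;> rcases Nat.eq_zero_or_pos j with rfl | hj'
    · rfl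
    · simp [hj'.ne'] at h
      exact absurd h.symm (hcon _ (by omega))
    · simp [hi'.ne'] at h
      exact absurd h (hcon _ (by omega))
    · simp [hi'.ne', hj'.ne'] at h
      have := hf.1 _ _ (by omega) (by omega) h
      omega
  · rcases Nat.eq_zero_or_pos i with rfl | hi'
    · simpa using hx.symm
    · have := hf.2 (i - 1) (by omega)
      rw [show i - 1 + 1 = i by omega] at this
      simpa [hi'.ne'] using this

lemma IsP.card {V : Type*} [Fintype V] {G : SimpleGraph V} {f : ℕ → V} {m : ℕ} (hf : IsP G f m) :
    m + 1 ≤ Fintype.card V := by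
  have := Fintype.card_le_of_injective (fun i : Fin (m + 1) => f i) (fun i j h =>
    Fin.ext (hf.1 _ _ (by omega) (by omega) h))
  simpa using this

lemma IsP.rot {V : Type*} {G : SimpleGraph V} {f : ℕ → V} {m : ℕ} (hf : IsP G f m)
    (h0 : G.Adj (f m) (f 0)) (i : ℕ) (hi : i ≤ m) :
    IsP G (fun k => if i + k ≤ m then f (i + k) else f (i + k - (m + 1))) m := by
  refine ⟨fun a b ha hb h => ?_, fun a ha => ?_⟩
  · dsimp only at h
    split_ifs at h <;> have := hf.1 _ _ (by omega) (by omega) h <;> omega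
  · dsimp only
    split_ifs with h1 h2 h2
    · exact hf.2 (i + a) (by omega)
    · rw [show i + a = m by omega, show i + (a + 1) - (m + 1) = 0 by omega]
      exact h0
    · omega
    · have := hf.2 (i + a - (m + 1)) (by omega)
      rwa [show i + a - (m + 1) + 1 = i + (a + 1) - (m + 1) by omega] at this

lemma IsP.ham {V : Type*} [Fintype V] {G : SimpleGraph V} (hG : G.Connected) {f : ℕ → V} {m : ℕ}
    (hf : IsP G f m) (hmax : ¬ ∃ g, IsP G g (m + 1)) (h0 : G.Adj (f m) (f 0)) :
    hamiltonianNumber G ≤ Fintype.card V := by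
  have hall : ∀ u, ∃ k, k ≤ m ∧ f k = u := by
    by_contra hcon
    push Not at hcon
    obtain ⟨u, hu⟩ := hcon
    obtain ⟨x, y, ⟨i, hi, rfl⟩, hy, hxy⟩ := exists_bdry hG {z | ∃ k, k ≤ m ∧ f k = z}
      (a := f 0) (b := u) ⟨0, by omega, rfl⟩ (by rintro ⟨k, hk, h⟩; exact hu k hk h)
    obtain ⟨k, hk, h⟩ := (hf.rot h0 i hi).ext_left hmax (x := y) (by simpa [hi] using hxy)
    apply hy
    split_ifs at h
    · exact ⟨_, by omega, h⟩
    · exact ⟨_, by omega, h⟩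
  obtain ⟨w, hl, hw⟩ := hf.walk' 0 m (by omega) le_rfl
  have := ham_le (w.concat h0) (fun u => by
    obtain ⟨k, hk, rfl⟩ := hall u
    rw [SimpleGraph.Walk.support_concat]
    simp [hw k (by omega) hk])
  rw [SimpleGraph.Walk.length_concat, hl] at this
  have := hf.card
  omega

lemma IsP.cross {V : Type*} {G : SimpleGraph V} {f : ℕ → V} {m l : ℕ}
    (hf : IsP G f m) (hl : l < m) (h2 : G.Adj (f m) (f l)) :
    IsP G (fun k => if k ≤ l then f k else f (m + l + 1 - k)) m := by
  refine ⟨fun a b ha hb h => ?_, fun a ha => ?_⟩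
  · dsimp only at h
    split_ifs at h <;> have := hf.1 _ _ (by omega) (by omega) h <;> omega
  · dsimp only
    split_ifs with h1 h3 h3
    · exact hf.2 a (by omega)
    · obtain rfl : a = l := by omega
      rw [show m + a + 1 - (a + 1) = m by omega]
      exact h2.symm
    · omega
    · have := hf.2 (m + l + 1 - (a + 1)) (by omega)
      rw [show m + l + 1 - (a + 1) + 1 = m + l + 1 - a by omega] at this
      exact this.symm

/-- Bermond's Ore-type bound: if `G` is a finite connected graph of order `n ≥ 3`
and `c ≤ n` is an integer such that `deg v + deg w ≥ c` for every pair of distinct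
non-adjacent vertices `v, w`, then `h(G) ≤ 2 * n - c`. -/
theorem hamiltonianNumber_le_of_ore {V : Type*} [Fintype V]
    (G : SimpleGraph V) [DecidableRel G.Adj] (hG : G.Connected)
    (hn : 3 ≤ Fintype.card V) (c : ℤ) (hc : c ≤ (Fintype.card V : ℤ))
    (hdeg : ∀ v w : V, v ≠ w → ¬ G.Adj v w →
      c ≤ (G.degree v : ℤ) + (G.degree w : ℤ)) :
    (hamiltonianNumber G : ℤ) ≤ 2 * (Fintype.card V : ℤ) - c := by
  classical
  obtain ⟨v0⟩ := hG.nonempty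
  obtain ⟨m, ⟨f, hf⟩, hmax⟩ : ∃ m, (∃ f, IsP G f m) ∧ ¬ ∃ f, IsP G f (m + 1) := by
    by_contra hcon
    push Not at hcon
    have hall : ∀ m, ∃ f, IsP G f m := by
      intro m
      induction m with
      | zero => exact ⟨fun _ => v0, fun i j hi hj _ => by omega, fun i hi => by omega⟩
      | succ m ih => exact hcon m ih
    obtain ⟨f, hf⟩ := hall (Fintype.card V)
    have := hf.card
    omega
  have : Nontrivial V := Fintype.one_lt_card_iff_nontrivial.1 (by omega)
  have hcard := hf.card
  by_cases h0 : G.Adj (f m) (f 0)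
  · have := hf.ham hG hmax h0
    omega
  let A := (Finset.range m).filter fun k => G.Adj (f 0) (f (k + 1))
  let B := (Finset.range m).filter fun k => G.Adj (f m) (f k)
  have hAmem : ∀ k, k ∈ A ↔ k < m ∧ G.Adj (f 0) (f (k + 1)) := by simp [A]
  have hBmem : ∀ k, k ∈ B ↔ k < m ∧ G.Adj (f m) (f k) := by simp [B]
  have hA : G.degree (f 0) ≤ A.card := by
    rw [← SimpleGraph.card_neighborFinset_eq_degree]
    refine (Finset.card_le_card (t := A.image fun k => f (k + 1)) fun x hx => ?_).trans
      Finset.card_image_le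
    rw [SimpleGraph.mem_neighborFinset] at hx
    obtain ⟨k, hk, rfl⟩ := hf.ext_left hmax hx
    rcases k with _ | k
    · exact absurd hx (G.irrefl)
    · exact Finset.mem_image.2 ⟨k, (hAmem k).2 ⟨by omega, hx⟩, rfl⟩
  have hB : G.degree (f m) ≤ B.card := by
    rw [← SimpleGraph.card_neighborFinset_eq_degree]
    refine (Finset.card_le_card (t := B.image fun k => f k) fun x hx => ?_).trans
      Finset.card_image_le
    rw [SimpleGraph.mem_neighborFinset] at hx
    obtain ⟨k, hk, rfl⟩ := hf.rev.ext_left hmax (x := x) (by simpa using hx)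
    rcases k with _ | k
    · exact absurd hx (by simp)
    · exact Finset.mem_image.2 ⟨_, (hBmem _).2 ⟨by omega, hx⟩, rfl⟩
  have hAne : A.Nonempty := Finset.card_pos.1
    ((hG.preconnected.degree_pos_of_nontrivial (f 0)).trans_le hA)
  have hBne : B.Nonempty := Finset.card_pos.1
    ((hG.preconnected.degree_pos_of_nontrivial (f m)).trans_le hB)
  have hm : 0 < m := by
    obtain ⟨k, hk⟩ := hAne
    have := (hAmem k).1 hk
    omega
  have hcd := hdeg (f 0) (f m) (fun h => by have := hf.1 _ _ (by omega) le_rfl h; omega)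
    (fun h => h0 h.symm)
  by_cases hcross : ∃ d l, l ∈ B ∧ l + d ∈ A
  · obtain ⟨l, hlB, hlA⟩ := Nat.find_spec hcross
    have hmin := fun e => Nat.find_min hcross (m := e)
    set d := Nat.find hcross
    obtain ⟨hl, hadjB⟩ := (hBmem _).1 hlB
    obtain ⟨hld, hadjA⟩ := (hAmem _).1 hlA
    rcases Nat.eq_zero_or_pos d with hd | hd
    · have := (hf.cross hl hadjB).ham hG hmax (by
        rw [hd] at hadjA
        simpa [show ¬ m ≤ l by omega, show m + l + 1 - m = l + 1 by omega] using hadjA.symm)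
      omega
    · -- genuine gap
      have hdisj : Disjoint A B := by
        rw [Finset.disjoint_left]
        intro t ht1 ht2
        exact hmin 0 hd ⟨t, ht2, ht1⟩
      have hsub : A ∪ B ⊆ Finset.range m \ Finset.Ioo l (l + d) := by
        intro t ht
        rw [Finset.mem_sdiff, Finset.mem_range, Finset.mem_Ioo]
        rcases Finset.mem_union.1 ht with ht | ht
        · refine ⟨((hAmem _).1 ht).1, fun ⟨h1, h2⟩ => ?_⟩
          exact hmin (t - l) (by omega) ⟨l, hlB, by rwa [show l + (t - l) = t by omega]⟩
        · refine ⟨((hBmem _).1 ht).1, fun ⟨h1, h2⟩ => ?_⟩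
          exact hmin (l + d - t) (by omega)
            ⟨t, ht, by rwa [show t + (l + d - t) = l + d by omega]⟩
      have hcc := Finset.card_le_card hsub
      rw [Finset.card_union_of_disjoint hdisj, Finset.card_sdiff_of_subset (by
        intro t ht
        rw [Finset.mem_Ioo] at ht
        rw [Finset.mem_range]
        omega), Finset.card_range, Nat.card_Ioo] at hcc
      obtain ⟨w1, hl1, hw1⟩ := hf.walk' 0 l (by omega) (by omega)
      obtain ⟨w2, hl2, hw2⟩ := hf.walk' (l + d + 1) m (by omega) le_rfl
      let q := ((w1.concat hadjB.symm).append w2.reverse).concat hadjA.symm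
      have hql : q.length = m + 1 - d := by
        simp only [q, SimpleGraph.Walk.length_concat, SimpleGraph.Walk.length_append,
          SimpleGraph.Walk.length_reverse, hl1, hl2]
        omega
      have hS : (Finset.range (m + 1) \ Finset.Ioc l (l + d)).image f ⊆ q.support.toFinset := by
        intro z hz
        obtain ⟨k, hk, rfl⟩ := Finset.mem_image.1 hz
        rw [Finset.mem_sdiff, Finset.mem_range, Finset.mem_Ioc] at hk
        by_cases hkl : k ≤ l
        · have := hw1 k (by omega) hkl
          simp [q, SimpleGraph.Walk.support_concat, SimpleGraph.Walk.mem_support_append_iff, this]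
        · have := hw2 k (by omega) (by omega)
          simp [q, SimpleGraph.Walk.support_concat, SimpleGraph.Walk.mem_support_append_iff, this]
      have hSc := Finset.card_le_card hS
      rw [Finset.card_image_of_injOn (by
        intro i hi j hj h
        simp only [Finset.coe_sdiff, Set.mem_sdiff, Finset.mem_coe, Finset.mem_range] at hi hj
        exact hf.1 _ _ (by omega) (by omega) h), Finset.card_sdiff_of_subset (by
        intro t ht
        rw [Finset.mem_Ioc] at ht
        rw [Finset.mem_range]
        omega), Finset.card_range, Nat.card_Ioc] at hSc
      have := ham_extend hG (Fintype.card V - (m + 1 - d)) _ q (by omega)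
      omega
  · push Not at hcross
    have hlt : ∀ k ∈ A, ∀ l ∈ B, k < l := by
      intro k hk l hl
      by_contra hkl
      exact hcross (k - l) l hl (by rwa [show l + (k - l) = k by omega])
    obtain ⟨a, haA, hamax⟩ := A.exists_max_image id hAne
    obtain ⟨b, hbB, hbmin⟩ := B.exists_min_image id hBne
    simp only [id] at hamax hbmin
    have hab := hlt a haA b hbB
    have hAc : A.card ≤ a + 1 := by
      have := Finset.card_le_card (s := A) (t := Finset.range (a + 1)) (fun k hk => by
        have := hamax k hk
        rw [Finset.mem_range]; omega)
      simpa using this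
    have hBc : B.card ≤ m - b := by
      have := Finset.card_le_card (s := B) (t := Finset.Ico b m) (fun k hk => by
        have := hbmin k hk
        have := ((hBmem k).1 hk).1
        rw [Finset.mem_Ico]; omega)
      simpa using this
    obtain ⟨ha, hadjA⟩ := (hAmem _).1 haA
    obtain ⟨hb, hadjB⟩ := (hBmem _).1 hbB
    obtain ⟨w1, hl1, hw1⟩ := hf.walk' 0 m (by omega) le_rfl
    obtain ⟨w2, hl2, hw2⟩ := hf.walk' (a + 1) b (by omega) (by omega)
    let q := ((w1.concat hadjB).append w2.reverse).concat hadjA.symm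
    have hql : q.length = m + 1 + (b - (a + 1)) + 1 := by
      simp only [q, SimpleGraph.Walk.length_concat, SimpleGraph.Walk.length_append,
        SimpleGraph.Walk.length_reverse, hl1, hl2]
      omega
    have hS : (Finset.range (m + 1)).image f ⊆ q.support.toFinset := by
      intro z hz
      obtain ⟨k, hk, rfl⟩ := Finset.mem_image.1 hz
      rw [Finset.mem_range] at hk
      have := hw1 k (by omega) (by omega)
      simp [q, SimpleGraph.Walk.support_concat, SimpleGraph.Walk.mem_support_append_iff, this]
    have hSc := Finset.card_le_card hS
    rw [Finset.card_image_of_injOn (by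
      intro i hi j hj h
      simp only [Finset.mem_coe, Finset.mem_range] at hi hj
      exact hf.1 _ _ (by omega) (by omega) h), Finset.card_range] at hSc
    have := ham_extend hG (Fintype.card V - (m + 1)) _ q (by omega)
    omega
end

section
/- For each integer n ≥ 3 and each integer k with n ≤ k ≤ 2(n − 1), there exists a finite connected graph G of order n whose Hamiltonian number is h(G) = k. -/
/-- Clique on the vertices below `m`, with all other vertices pendant at `0`. -/
def hnGraph (n m : ℕ) : SimpleGraph (Fin n) where
  Adj i j := i ≠ j ∧ (i.val = 0 ∨ j.val = 0 ∨ (i.val < m ∧ j.val < m))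
  symm := ⟨fun i j h => ⟨h.1.symm, by tauto⟩⟩
  loopless := ⟨fun i h => h.1 rfl⟩

theorem hn_walkA (n m : ℕ) (hm : m ≤ n) (h0 : 0 < n) (j : ℕ) (hj : j < m) :
    ∃ w : (hnGraph n m).Walk ⟨0, h0⟩ ⟨j, by omega⟩,
      w.length = j ∧ ∀ i : Fin n, i.val ≤ j → i ∈ w.support := by
  induction j with
  | zero =>
    refine ⟨.nil, rfl, fun i hi => ?_⟩
    have : i = ⟨0, h0⟩ := Fin.ext (by simpa using hi)
    simp [this]
  | succ j ih =>
    obtain ⟨w, hl, hs⟩ := ih (by omega)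
    have hadj : (hnGraph n m).Adj ⟨j, by omega⟩ ⟨j+1, by omega⟩ :=
      ⟨by simp, Or.inr (Or.inr ⟨by simp; omega, by simpa using hj⟩)⟩
    refine ⟨w.concat hadj, by simp [hl], fun i hi => ?_⟩
    rw [SimpleGraph.Walk.support_concat]
    rcases Nat.lt_or_ge j i.val with h | h
    · have : i = ⟨j+1, by omega⟩ := Fin.ext (by simp; omega)
      simp [this]
    · simp [hs i h]

theorem hn_walkB (n m : ℕ) (hm2 : 2 ≤ m) (hm : m ≤ n) (h0 : 0 < n) (j : ℕ) (hj : m + j ≤ n) :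
    ∃ w : (hnGraph n m).Walk ⟨0, h0⟩ ⟨0, h0⟩,
      w.length = m + 2 * j ∧ ∀ i : Fin n, i.val < m + j → i ∈ w.support := by
  induction j with
  | zero =>
    obtain ⟨w, hl, hs⟩ := hn_walkA n m hm h0 (m-1) (by omega)
    have hadj : (hnGraph n m).Adj ⟨m-1, by omega⟩ ⟨0, h0⟩ :=
      ⟨by simp; omega, Or.inr (Or.inl rfl)⟩
    refine ⟨w.concat hadj, by simp [hl]; omega, fun i hi => ?_⟩
    rw [SimpleGraph.Walk.support_concat]
    simp [hs i (by omega)]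
  | succ j ih =>
    obtain ⟨w, hl, hs⟩ := ih (by omega)
    have hadj : (hnGraph n m).Adj ⟨0, h0⟩ ⟨m+j, by omega⟩ :=
      ⟨by simp; omega, Or.inl rfl⟩
    refine ⟨(w.concat hadj).concat hadj.symm, by simp [hl]; omega, fun i hi => ?_⟩
    rw [SimpleGraph.Walk.support_concat, SimpleGraph.Walk.support_concat]
    rcases Nat.lt_or_ge i.val (m+j) with h | h
    · simp [hs i h]
    · have : i = ⟨m+j, by omega⟩ := Fin.ext (by simp; omega)
      simp [this]

theorem hn_boundary {V : Type*} [DecidableEq V] {G : SimpleGraph V} {v : V} (w : G.Walk v v)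
    (hw : ∀ u, u ∈ w.support) (S : Set V) (a b : V) (ha : a ∈ S) (hb : b ∉ S) :
    ∃ d ∈ w.darts, d.fst ∈ S ∧ d.snd ∉ S := by
  by_cases hv : v ∈ S
  · obtain ⟨d, hd, h⟩ := (w.takeUntil b (hw b)).exists_boundary_dart S hv hb
    exact ⟨d, w.darts_takeUntil_subset (hw b) hd, h⟩
  · obtain ⟨d, hd, h⟩ := (w.dropUntil a (hw a)).exists_boundary_dart S ha hv
    exact ⟨d, w.darts_dropUntil_subset (hw a) hd, h⟩

theorem hn_lower_s7 (n m : ℕ) (hm2 : 2 ≤ m) (hm : m ≤ n) (v : Fin n)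
    (w : (hnGraph n m).Walk v v) (hw : ∀ u, u ∈ w.support) : 2 * n - m ≤ w.length := by
  classical
  set D : Finset (hnGraph n m).Dart := w.darts.toFinset with hD
  have hc : D.card ≤ w.length := by
    rw [← SimpleGraph.Walk.length_darts]; exact List.toFinset_card_le _
  have h1 : n - 1 ≤ (D.filter (fun d => d.snd.val ≠ 0)).card := by
    have hsub : Finset.Ico 1 n ⊆
        (D.filter (fun d => d.snd.val ≠ 0)).image (fun d => d.snd.val) := by
      intro x hx
      rw [Finset.mem_Ico] at hx
      obtain ⟨d, hd, -, h2⟩ := hn_boundary w hw {u | u.val ≠ x} ⟨0, by omega⟩ ⟨x, hx.2⟩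
        (by simp; omega) (by simp)
      simp only [Set.mem_setOf_eq, not_not] at h2
      rw [Finset.mem_image]
      exact ⟨d, by simp only [hD, Finset.mem_filter, List.mem_toFinset]; exact ⟨hd, by omega⟩, h2⟩
    have := (Finset.card_le_card hsub).trans Finset.card_image_le
    simpa using this
  have h2 : n - m + 1 ≤ (D.filter (fun d => ¬ d.snd.val ≠ 0)).card := by
    have hsub : insert 1 (Finset.Ico m n) ⊆
        (D.filter (fun d => ¬ d.snd.val ≠ 0)).image
          (fun d => if d.fst.val < m then 1 else d.fst.val) := by
      intro x hx
      rw [Finset.mem_insert, Finset.mem_Ico] at hx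
      rw [Finset.mem_image]
      rcases hx with rfl | hx
      · obtain ⟨d, hd, h1, h2⟩ := hn_boundary w hw {u | 0 < u.val ∧ u.val < m}
          ⟨1, by omega⟩ ⟨0, by omega⟩ (by simp; omega) (by simp)
        simp only [Set.mem_setOf_eq] at h1 h2
        have ha := d.adj.2
        refine ⟨d, ?_, by simp [h1.2]⟩
        simp only [hD, Finset.mem_filter, List.mem_toFinset]
        exact ⟨hd, by omega⟩
      · obtain ⟨d, hd, h1, h2⟩ := hn_boundary w hw {u | u.val = x}
          ⟨x, hx.2⟩ ⟨0, by omega⟩ (by simp) (by simp; omega)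
        simp only [Set.mem_setOf_eq] at h1 h2
        have ha := d.adj.2
        refine ⟨d, ?_, by rw [if_neg (by omega), h1]⟩
        simp only [hD, Finset.mem_filter, List.mem_toFinset]
        exact ⟨hd, by omega⟩
    have := (Finset.card_le_card hsub).trans Finset.card_image_le
    rw [Finset.card_insert_of_notMem (by simp; omega)] at this
    simpa using this
  have h3 := Finset.card_filter_add_card_filter_not (s := D) (fun d => d.snd.val ≠ 0)
  omega

/-- For each integer `n ≥ 3` and each integer `k` with `n ≤ k ≤ 2 * (n - 1)`, there
is a connected graph of order `n` whose Hamiltonian number is `k`. -/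
theorem exists_graph_with_hamiltonianNumber (n k : ℕ) (hn : 3 ≤ n)
    (hk₁ : n ≤ k) (hk₂ : k ≤ 2 * (n - 1)) :
    ∃ G : SimpleGraph (Fin n), G.Connected ∧ hamiltonianNumber G = k := by
  have h0 : 0 < n := by omega
  obtain ⟨w, hl, hs⟩ := hn_walkB n (2 * n - k) (by omega) (by omega) h0 (k - n) (by omega)
  have hs' : ∀ u, u ∈ w.support := fun u => hs u (by omega)
  refine ⟨hnGraph n (2 * n - k), ?_, ?_⟩
  · haveI : Nonempty (Fin n) := ⟨⟨0, h0⟩⟩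
    refine SimpleGraph.Connected.mk fun a b => ?_
    exact ((w.takeUntil a (hs' a)).reachable.symm).trans (w.takeUntil b (hs' b)).reachable
  · refine le_antisymm (Nat.sInf_le ⟨_, w, hs', by omega⟩) ?_
    refine le_csInf ⟨_, _, w, hs', rfl⟩ ?_
    rintro l ⟨v, w', hw', rfl⟩
    have := hn_lower_s7 n (2 * n - k) (by omega) (by omega) v w' hw'
    omega
end
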